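/- arXiv:2211.16286 — 3 statements merged into one kernel-verified Lean document; each statement's English description precedes it below -/
import Mathlib

section
/- Let φ : ℝ^d → ℝ be twice continuously differentiable with ‖φ‖_p and max_{|κ|=2} ‖∂_κ φ‖_p finite for all 1 ≤ p ≤ ∞. Then for every r > 0 and every 1 ≤ p ≤ ∞: ‖φ̄(·, r) − φ‖_p ≤ min{ 2 ‖φ‖_p, (d/2) r² max_{|κ|=2} ‖∂_κ φ‖_p }. -/
open MeasureTheory Metric Set
open scoped ENNReal Classical

noncomputable section

/-- Euclidean space `ℝ^d`. -/
abbrev Euc (d : ℕ) : Type := EuclideanSpace ℝ (Fin d)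

/-- The ball average `φ̄(x,r) = (1/V_r) ∫_{B(x,r)} φ(y) dy` (with `φ̄(x,0) = φ(x)`). -/
def ballAvg {d : ℕ} (φ : Euc d → ℝ) (r : ℝ) (x : Euc d) : ℝ :=
  if r = 0 then φ x
  else ((volume (Metric.ball x r)).toReal)⁻¹ * ∫ y in Metric.ball x r, φ y

/-- Partial derivative of `ψ` in the `i`-th coordinate direction. -/
def pd {d : ℕ} (i : Fin d) (ψ : Euc d → ℝ) (x : Euc d) : ℝ :=
  fderiv ℝ ψ x (EuclideanSpace.single i 1)

/-- Iterated partial derivative `∂_κ` along a list of coordinate directions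
(a multi-index `κ` with `|κ|` the length of the list). -/
def listD {d : ℕ} : List (Fin d) → (Euc d → ℝ) → Euc d → ℝ
  | [], ψ => ψ
  | i :: l, ψ => pd i (listD l ψ)

lemma mink_aux {S X : Type*} [MeasurableSpace S] [MeasurableSpace X] (ν : Measure S)
    [IsProbabilityMeasure ν] (μ : Measure X) [SFinite μ] (f : X → ℝ) (G : S → X → ℝ)
    (hG : Measurable (Function.uncurry G)) (M : ℝ≥0∞) (p : ℝ≥0∞) (hp : 1 ≤ p)
    (hf : ∀ x, ‖f x‖ₑ ≤ ∫⁻ s, ‖G s x‖ₑ ∂ν)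
    (hM : ∀ᵐ s ∂ν, eLpNorm (G s) p μ ≤ M) : eLpNorm f p μ ≤ M := by
  have hGx : ∀ x, Measurable (fun s => G s x) := fun x => hG.comp (g := Function.uncurry G) (f := fun s => (s, x)) (by fun_prop)
  by_cases hpt : p = ⊤
  · subst hpt
    rw [eLpNorm_exponent_top]
    apply eLpNormEssSup_le_of_ae_enorm_bound
    have h1 : ∀ᵐ s ∂ν, ∀ᵐ x ∂μ, ‖G s x‖ₑ ≤ M := by
      filter_upwards [hM] with s hs
      rw [eLpNorm_exponent_top] at hs
      filter_upwards [enorm_ae_le_eLpNormEssSup (G s) μ] with x hx using hx.trans hs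
    rw [Measure.ae_ae_comm (p := fun s x => ‖G s x‖ₑ ≤ M)
      (measurableSet_le hG.enorm measurable_const)] at h1
    filter_upwards [h1] with x hx
    calc _ ≤ _ := hf x
      _ ≤ ∫⁻ s, M ∂ν := lintegral_mono_ae hx
      _ = M := by simp
  · have hp0 : p ≠ 0 := (zero_lt_one.trans_le hp).ne'
    have hq : 0 < p.toReal := ENNReal.toReal_pos hp0 hpt
    rw [eLpNorm_eq_lintegral_rpow_enorm_toReal hp0 hpt]
    rw [one_div, ENNReal.rpow_inv_le_iff hq]
    have h2 : ∀ x, ‖f x‖ₑ ^ p.toReal ≤ ∫⁻ s, ‖G s x‖ₑ ^ p.toReal ∂ν := by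
      intro x
      rw [← ENNReal.le_rpow_inv_iff hq, ← one_div,
        ← eLpNorm_eq_lintegral_rpow_enorm_toReal hp0 hpt]
      refine (hf x).trans ?_
      rw [← eLpNorm_one_eq_lintegral_enorm]
      exact eLpNorm_le_eLpNorm_of_exponent_le hp (hGx x).aestronglyMeasurable
    calc _ ≤ ∫⁻ x, ∫⁻ s, ‖G s x‖ₑ ^ p.toReal ∂ν ∂μ := lintegral_mono h2
      _ = ∫⁻ s, ∫⁻ x, ‖G s x‖ₑ ^ p.toReal ∂μ ∂ν := by
        apply lintegral_lintegral_swap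
        exact ((hG.comp measurable_swap).enorm.pow_const _).aemeasurable
      _ ≤ ∫⁻ s, M ^ p.toReal ∂ν := by
        apply lintegral_mono_ae
        filter_upwards [hM] with s hs
        rw [eLpNorm_eq_lintegral_rpow_enorm_toReal hp0 hpt, one_div,
          ENNReal.rpow_inv_le_iff hq] at hs
        exact hs
      _ = _ := by simp

lemma fd_expand {d : ℕ} (ψ : Euc d → ℝ) (x z : Euc d) :
    fderiv ℝ ψ x z = ∑ i, z i * pd i ψ x := by
  have : z = ∑ i, z i • EuclideanSpace.single i (1 : ℝ) := by
    ext j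
    simp [Finset.sum_apply, Pi.single_apply]
  conv_lhs => rw [this]
  simp [pd]

lemma pd_contDiff {d : ℕ} {ψ : Euc d → ℝ} {n m : WithTop ℕ∞} (h : ContDiff ℝ n ψ)
    (hm : m + 1 ≤ n) (i : Fin d) : ContDiff ℝ m (pd i ψ) :=
  (h.fderiv_right hm).clm_apply contDiff_const

/-- second directional derivative -/
def hess {d : ℕ} (φ : Euc d → ℝ) (z y : Euc d) : ℝ :=
  ∑ j, z j * ∑ i, z i * pd i (pd j φ) y

lemma hess_cont {d : ℕ} {φ : Euc d → ℝ} (hφ : ContDiff ℝ 2 φ) (z : Euc d) :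
    Continuous (hess φ z) := by
  unfold hess
  have : ∀ i j, Continuous (pd i (pd j φ)) := fun i j =>
    (pd_contDiff (m := 0) (pd_contDiff (m := 1) hφ (by norm_num) j) (by norm_num) i).continuous
  fun_prop

lemma taylor_aux {d : ℕ} {φ : Euc d → ℝ} (hφ : ContDiff ℝ 2 φ) (z x : Euc d) :
    φ (x + z) - φ x - fderiv ℝ φ x z = ∫ t in (0:ℝ)..1, (1 - t) * hess φ z (x + t • z) := by
  have hl : ∀ t : ℝ, HasDerivAt (fun t : ℝ => x + t • z) z t := fun t => by
    simpa using ((hasDerivAt_id t).smul_const z).const_add x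
  have h1 : ∀ t : ℝ, HasDerivAt (fun t : ℝ => φ (x + t • z)) (fderiv ℝ φ (x + t • z) z) t :=
    fun t => ((hφ.differentiable (by norm_num)) _).hasFDerivAt.comp_hasDerivAt t (hl t)
  have h2 : ∀ t : ℝ, HasDerivAt (fun t : ℝ => fderiv ℝ φ (x + t • z) z)
      (hess φ z (x + t • z)) t := by
    intro t
    simp_rw [fd_expand φ _ z]
    unfold hess
    apply HasDerivAt.fun_sum
    intro j _
    apply HasDerivAt.const_mul
    rw [← fd_expand]
    have hj := pd_contDiff (m := 1) hφ (by norm_num) j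
    exact ((hj.differentiable (by norm_num)) _).hasFDerivAt.comp_hasDerivAt t (hl t)
  have h3 : ∀ t : ℝ, HasDerivAt
      (fun t : ℝ => φ (x + t • z) + (1 - t) * fderiv ℝ φ (x + t • z) z)
      ((1 - t) * hess φ z (x + t • z)) t := by
    intro t
    have := (h1 t).add (((hasDerivAt_id t).const_sub 1).mul (h2 t))
    exact this.congr_deriv (by simp)
  have hc := hess_cont hφ z
  rw [intervalIntegral.integral_eq_sub_of_hasDerivAt (fun t _ => h3 t)
    (Continuous.intervalIntegrable (by fun_prop) _ _)]
  simp
  ring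

lemma trans_norm {d : ℕ} {g : Euc d → ℝ} (hg : Continuous g) (p : ℝ≥0∞) (v : Euc d) :
    eLpNorm (fun x => g (x + v)) p volume = eLpNorm g p volume :=
  eLpNorm_comp_measurePreserving hg.aestronglyMeasurable (measurePreserving_add_right volume v)

lemma hess_norm {d : ℕ} {φ : Euc d → ℝ} (hφ : ContDiff ℝ 2 φ) (z : Euc d) (p : ℝ≥0∞)
    (hp : 1 ≤ p) (M : ℝ≥0∞) (hM : ∀ i j, eLpNorm (pd i (pd j φ)) p volume ≤ M) :
    eLpNorm (hess φ z) p volume ≤ ENNReal.ofReal (d * ‖z‖ ^ 2) * M := by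
  have hc : ∀ i j, Continuous (pd i (pd j φ)) := fun i j =>
    (pd_contDiff (m := 0) (pd_contDiff (m := 1) hφ (by norm_num) j) (by norm_num) i).continuous
  have e : hess φ z = ∑ j, ∑ i, (z j * z i) • pd i (pd j φ) := by
    ext y
    simp [hess, Finset.sum_apply, Finset.mul_sum, mul_assoc]
  rw [e]
  calc _ ≤ ∑ j, eLpNorm (∑ i, (z j * z i) • pd i (pd j φ)) p volume :=
        eLpNorm_sum_le (fun j _ => (Finset.aestronglyMeasurable_sum _ fun i _ =>
          ((hc i j).aestronglyMeasurable.const_smul _))) hp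
    _ ≤ ∑ j, ∑ i, eLpNorm ((z j * z i) • pd i (pd j φ)) p volume :=
        Finset.sum_le_sum fun j _ => eLpNorm_sum_le
          (fun i _ => ((hc i j).aestronglyMeasurable.const_smul _)) hp
    _ ≤ ∑ j, ∑ i, ENNReal.ofReal (|z j| * |z i|) * M := by
        refine Finset.sum_le_sum fun j _ => Finset.sum_le_sum fun i _ => ?_
        rw [eLpNorm_const_smul, ← abs_mul, ← Real.norm_eq_abs, ofReal_norm]
        gcongr
        exact hM i j
    _ = ENNReal.ofReal ((∑ j, |z j|) ^ 2) * M := by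
        simp_rw [← Finset.sum_mul]
        congr 1
        rw [sq, Finset.sum_mul_sum, ENNReal.ofReal_sum_of_nonneg
          (fun _ _ => Finset.sum_nonneg fun _ _ => by positivity)]
        refine Finset.sum_congr rfl fun j _ => ?_
        rw [ENNReal.ofReal_sum_of_nonneg (fun _ _ => by positivity)]
    _ ≤ _ := by
        gcongr
        rw [EuclideanSpace.norm_sq_eq]
        simpa using sq_sum_le_card_mul_sum_sq (s := Finset.univ) (f := fun j => |z j|)

lemma rem_norm {d : ℕ} {φ : Euc d → ℝ} (hφ : ContDiff ℝ 2 φ) (z : Euc d) (p : ℝ≥0∞)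
    (hp : 1 ≤ p) (M : ℝ≥0∞) (hM : ∀ i j, eLpNorm (pd i (pd j φ)) p volume ≤ M) :
    eLpNorm (fun x => φ (x + z) - φ x - fderiv ℝ φ x z) p volume
      ≤ ENNReal.ofReal (d / 2 * ‖z‖ ^ 2) * M := by
  let ν : Measure ℝ := (volume.restrict (Ioc 0 1)).withDensity (fun t => ENNReal.ofReal (2 * (1 - t)))
  have hdm : Measurable (fun t : ℝ => ENNReal.ofReal (2 * (1 - t))) := by fun_prop
  have hν : IsProbabilityMeasure ν := by
    constructor
    simp only [ν, withDensity_apply _ MeasurableSet.univ, Measure.restrict_univ]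
    rw [← ofReal_integral_eq_lintegral_ofReal, ← intervalIntegral.integral_of_le zero_le_one]
    · rw [intervalIntegral.integral_const_mul, intervalIntegral.integral_sub (by simp) (by simp)]
      rw [← ENNReal.ofReal_one]
      congr 1
      simp
      norm_num
    · exact (Continuous.integrableOn_Icc (by fun_prop)).mono_set Ioc_subset_Icc_self
    · filter_upwards [ae_restrict_mem measurableSet_Ioc] with t ht
      have := ht.2
      simp; linarith
  have hc := hess_cont hφ z
  refine mink_aux ν volume _ (fun t x => (1/2 : ℝ) * hess φ z (x + t • z)) ?_ _ p hp ?_ ?_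
  · exact Continuous.measurable (by unfold Function.uncurry; fun_prop)
  · intro x
    rw [taylor_aux hφ, intervalIntegral.integral_of_le zero_le_one]
    refine (enorm_integral_le_lintegral_enorm _).trans ?_
    simp only [ν]
    rw [lintegral_withDensity_eq_lintegral_mul _ hdm
      (Continuous.measurable (by fun_prop))]
    refine lintegral_mono_ae ?_
    filter_upwards [ae_restrict_mem measurableSet_Ioc] with t ht
    have h0 : 0 ≤ 2 * (1 - t) := by have := ht.2; linarith
    simp only [Pi.mul_apply]
    rw [← Real.enorm_eq_ofReal h0, ← enorm_mul]
    apply le_of_eq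
    congr 1
    ring
  · refine Filter.Eventually.of_forall fun t => ?_
    calc _ = ‖(1/2 : ℝ)‖ₑ * eLpNorm (fun x => hess φ z (x + t • z)) p volume :=
          eLpNorm_const_smul (1/2 : ℝ) (fun x => hess φ z (x + t • z)) p volume
      _ ≤ ENNReal.ofReal (1/2) * (ENNReal.ofReal (d * ‖z‖ ^ 2) * M) := by
          rw [trans_norm hc, Real.enorm_eq_ofReal (by norm_num)]
          gcongr
          exact hess_norm hφ z p hp M hM
      _ = _ := by
          rw [← mul_assoc, ← ENNReal.ofReal_mul (by norm_num)]
          congr 2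
          ring

/-- uniform probability on the ball -/
def unif (d : ℕ) (r : ℝ) : Measure (Euc d) :=
  (volume (Metric.ball (0 : Euc d) r))⁻¹ • volume.restrict (Metric.ball 0 r)

lemma vol_ball {d : ℕ} {r : ℝ} (hr : 0 < r) :
    volume (Metric.ball (0 : Euc d) r) ≠ 0 ∧ volume (Metric.ball (0 : Euc d) r) ≠ ⊤ :=
  ⟨(measure_ball_pos _ _ hr).ne', measure_ball_lt_top.ne⟩

lemma unif_prob {d : ℕ} {r : ℝ} (hr : 0 < r) : IsProbabilityMeasure (unif d r) := by
  constructor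
  simp only [unif, Measure.smul_apply, Measure.restrict_univ, Measure.restrict_apply_univ,
    smul_eq_mul]
  exact ENNReal.inv_mul_cancel (vol_ball hr).1 (vol_ball hr).2

lemma unif_int {d : ℕ} {r : ℝ} (hr : 0 < r) {g : Euc d → ℝ} (hg : Continuous g) :
    Integrable g (unif d r) := by
  apply Integrable.smul_measure _ (ENNReal.inv_ne_top.2 (vol_ball hr).1)
  exact (hg.continuousOn.integrableOn_compact (isCompact_closedBall 0 r)).mono_set
    ball_subset_closedBall

lemma unif_mem {d : ℕ} (r : ℝ) : ∀ᵐ z ∂(unif d r), z ∈ Metric.ball (0 : Euc d) r :=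
  Measure.ae_smul_measure (ae_restrict_mem measurableSet_ball) _

lemma unif_lin {d : ℕ} (r : ℝ) (L : Euc d →L[ℝ] ℝ) : ∫ z, L z ∂(unif d r) = 0 := by
  have h : ∫ z in Metric.ball (0 : Euc d) r, L z = 0 := by
    rw [← integral_indicator measurableSet_ball]
    have h1 := integral_neg_eq_self ((Metric.ball (0 : Euc d) r).indicator (fun z => L z)) volume
    have h2 : ∀ z, (Metric.ball (0 : Euc d) r).indicator (fun z => L z) (-z)
        = - (Metric.ball (0 : Euc d) r).indicator (fun z => L z) z := by
      intro z
      by_cases hz : z ∈ Metric.ball (0 : Euc d) r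
      · rw [indicator_of_mem hz, indicator_of_mem (by simpa using hz)]
        simp
      · rw [indicator_of_notMem hz, indicator_of_notMem (by simpa using hz)]
        simp
    simp_rw [h2] at h1
    rw [integral_neg] at h1
    linarith
  rw [unif, integral_smul_measure, h, smul_zero]

lemma ballAvg_eq {d : ℕ} {r : ℝ} (hr : 0 < r) (φ : Euc d → ℝ) (x : Euc d) :
    ballAvg φ r x = ∫ z, φ (x + z) ∂(unif d r) := by
  rw [ballAvg, if_neg hr.ne', unif, integral_smul_measure, ENNReal.toReal_inv, smul_eq_mul]
  have hv : volume (Metric.ball x r) = volume (Metric.ball (0 : Euc d) r) :=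
    Measure.addHaar_ball_center volume x r
  rw [hv]
  congr 1
  have := (measurePreserving_add_left volume x).setIntegral_preimage_emb
    (measurableEmbedding_addLeft x) φ (Metric.ball x r)
  rw [← this]
  congr 2
  ext z
  simp

/-- for twice continuously differentiable `φ` with `‖φ‖_p` and
`max_{|κ|=2} ‖∂_κ φ‖_p` finite for all `1 ≤ p ≤ ∞`, for every `r > 0` and `1 ≤ p ≤ ∞`,
`‖φ̄(·, r) − φ‖_p ≤ min{ 2 ‖φ‖_p, (d/2) r² max_{|κ|=2} ‖∂_κ φ‖_p }`. -/
theorem stmt6 {d : ℕ} (φ : Euc d → ℝ) (hφ : ContDiff ℝ 2 φ)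
    (hfin : ∀ p : ℝ≥0∞, 1 ≤ p → eLpNorm φ p volume < ⊤ ∧
      (⨆ (l : List (Fin d)) (_ : l.length = 2), eLpNorm (listD l φ) p volume) < ⊤) :
    ∀ r : ℝ, 0 < r → ∀ p : ℝ≥0∞, 1 ≤ p →
      eLpNorm (fun x => ballAvg φ r x - φ x) p volume
        ≤ min (2 * eLpNorm φ p volume)
            (ENNReal.ofReal ((d : ℝ) / 2 * r ^ 2) *
              ⨆ (l : List (Fin d)) (_ : l.length = 2), eLpNorm (listD l φ) p volume) := by
  intro r hr p hp
  have := unif_prob (d := d) hr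
  have hφc := hφ.continuous
  have hd : Continuous (fderiv ℝ φ) := hφ.continuous_fderiv (by norm_num)
  have hdiff : ∀ x, ballAvg φ r x - φ x = ∫ z, (φ (x + z) - φ x) ∂(unif d r) := by
    intro x
    rw [ballAvg_eq hr, integral_sub (unif_int hr (by fun_prop)) (integrable_const _)]
    simp
  refine le_min ?_ ?_
  · refine mink_aux (unif d r) volume _ (fun z x => φ (x + z) - φ x) ?_ _ p hp ?_ ?_
    · exact Continuous.measurable (by unfold Function.uncurry; fun_prop)
    · intro x
      rw [hdiff]
      exact enorm_integral_le_lintegral_enorm _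
    · refine Filter.Eventually.of_forall fun z => ?_
      calc _ ≤ eLpNorm (fun x => φ (x + z)) p volume + eLpNorm φ p volume :=
            eLpNorm_sub_le (Continuous.aestronglyMeasurable (by fun_prop))
              hφc.aestronglyMeasurable hp
        _ = _ := by rw [trans_norm hφc, two_mul]
  · refine mink_aux (unif d r) volume _ (fun z x => φ (x + z) - φ x - fderiv ℝ φ x z)
      ?_ _ p hp ?_ ?_
    · exact Continuous.measurable (by unfold Function.uncurry; fun_prop)
    · intro x
      have h : ballAvg φ r x - φ x
          = ∫ z, (φ (x + z) - φ x - fderiv ℝ φ x z) ∂(unif d r) := by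
        rw [integral_sub (unif_int hr (by fun_prop)) (unif_int hr (by fun_prop)), unif_lin,
          hdiff, sub_zero]
      rw [h]
      exact enorm_integral_le_lintegral_enorm _
    · filter_upwards [unif_mem (d := d) r] with z hz
      refine (rem_norm hφ z p hp
        (⨆ (l : List (Fin d)) (_ : l.length = 2), eLpNorm (listD l φ) p volume) (fun i j => ?_)).trans ?_
      · exact le_iSup₂_of_le (f := fun (l : List (Fin d)) (_ : l.length = 2) =>
          eLpNorm (listD l φ) p volume) [i, j] rfl le_rfl
      · have : ‖z‖ ≤ r := by simpa using (mem_ball_zero_iff.1 hz).le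
        gcongr

end
end

section
/- Let α ∈ (0,2), ζ > 0, and let φ : ℝ^d → ℝ be twice continuously differentiable with ‖φ‖_∞ and max_{|κ|≤2} ‖∂_κ φ‖_∞ finite. Then for every x ∈ ℝ^d the integral ζ ∫₀^∞ (φ̄(x,r) − φ(x)) dr/r^{1+α} is absolutely convergent, the limit lim_{ε→0} ∫_{ℝ^d ∖ B(x,ε)} (φ(z) − φ(x))/‖z−x‖^{d+α} dz exists, and ζ ∫₀^∞ (φ̄(x,r) − φ(x)) dr/r^{1+α} = (ζ/(V_1(d+α))) lim_{ε→0} ∫_{ℝ^d ∖ B(x,ε)} (φ(z) − φ(x))/‖z−x‖^{d+α} dz. -/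
open MeasureTheory Metric Set Filter
open scoped ENNReal Classical Topology

noncomputable section

/-- The volume of the unit ball in `ℝ^d`. -/
def V1 (d : ℕ) : ℝ := (volume (Metric.ball (0 : Euc d) 1)).toReal

lemma aux_r (α : ℝ) (hα0 : 0 < α) (hα2 : α < 2) :
    IntegrableOn (fun r : ℝ => min 1 (r ^ 2) * r ^ (-(1 + α))) (Set.Ioi 0) volume := by
  have hm : Measurable (fun r : ℝ => min 1 (r ^ 2) * r ^ (-(1 + α))) := by fun_prop
  rw [← Set.Ioc_union_Ioi_eq_Ioi (zero_le_one (α := ℝ))]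
  apply IntegrableOn.union
  · have h : IntegrableOn (fun r : ℝ => r ^ (1 - α)) (Set.Ioc 0 1) volume := by
      rw [← intervalIntegrable_iff_integrableOn_Ioc_of_le zero_le_one]
      exact intervalIntegral.intervalIntegrable_rpow' (by linarith)
    refine Integrable.mono' h hm.aestronglyMeasurable ?_
    filter_upwards [ae_restrict_mem measurableSet_Ioc] with r hr
    have h0 : 0 < r := hr.1
    rw [Real.norm_of_nonneg (by positivity)]
    calc min 1 (r ^ 2) * r ^ (-(1 + α)) ≤ r ^ 2 * r ^ (-(1 + α)) := by
          gcongr; exact min_le_right _ _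
      _ = r ^ (1 - α) := by
          rw [← Real.rpow_natCast, ← Real.rpow_add h0]; congr 1; push_cast; ring
  · have h : IntegrableOn (fun r : ℝ => r ^ (-(1 + α))) (Set.Ioi 1) volume :=
      integrableOn_Ioi_rpow_of_lt (by linarith) one_pos
    refine Integrable.mono' h hm.aestronglyMeasurable ?_
    filter_upwards [ae_restrict_mem measurableSet_Ioi] with r hr
    have h0 : 0 < r := one_pos.trans hr
    rw [Real.norm_of_nonneg (by positivity)]
    calc min 1 (r ^ 2) * r ^ (-(1 + α)) ≤ 1 * r ^ (-(1 + α)) := by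
          gcongr; exact min_le_left _ _
      _ = _ := one_mul _

lemma vol_ball' {d : ℕ} (x : Euc d) {r : ℝ} (hr : 0 < r) :
    (volume (Metric.ball x r)).toReal = r ^ d * V1 d := by
  rw [Measure.addHaar_ball_of_pos _ _ hr, ENNReal.toReal_mul, ENNReal.toReal_ofReal (by positivity)]
  simp [V1]

/-- the two-variable kernel -/
def kerF {d : ℕ} (α : ℝ) (k : Euc d → ℝ) (p : ℝ × Euc d) : ℝ :=
  Set.indicator {p : ℝ × Euc d | ‖p.2‖ < p.1} (fun p => k p.2 * p.1 ^ (-(1 + α + d))) p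

lemma kerF_left {d : ℕ} (α : ℝ) (k : Euc d → ℝ) (r : ℝ) :
    (fun y => kerF α k (r, y)) =
      (Metric.ball (0 : Euc d) r).indicator (fun y => k y * r ^ (-(1 + α + d))) := by
  ext y
  simp [kerF, Set.indicator]

lemma kerF_right {d : ℕ} (α : ℝ) (k : Euc d → ℝ) (y : Euc d) :
    (fun r => kerF α k (r, y)) =
      (Set.Ioi ‖y‖).indicator (fun r => k y * r ^ (-(1 + α + d))) := by
  ext y
  simp [kerF, Set.indicator]

lemma kerF_meas {d : ℕ} (α : ℝ) (k : Euc d → ℝ) (hk : Measurable k) : Measurable (kerF α k) := by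
  unfold kerF
  apply Measurable.indicator
  · fun_prop
  · exact measurableSet_lt (by fun_prop) (by fun_prop)

lemma kerF_integrable {d : ℕ} (α : ℝ) (hα0 : 0 < α) (hα2 : α < 2) (k : Euc d → ℝ)
    (hk : Measurable k) (C : ℝ) (h1 : ∀ y, |k y| ≤ C) (h2 : ∀ y, |k y| ≤ C * ‖y‖ ^ 2) :
    Integrable (kerF α k) ((volume.restrict (Set.Ioi 0)).prod volume) := by
  have hC : 0 ≤ C := (abs_nonneg _).trans (h1 0)
  rw [integrable_prod_iff (kerF_meas α k hk).aestronglyMeasurable]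
  have key : ∀ r : ℝ, 0 < r → ∀ y ∈ Metric.ball (0 : Euc d) r,
      ‖k y * r ^ (-(1 + α + d))‖ ≤ C * min 1 (r ^ 2) * r ^ (-(1 + α + d)) := by
    intro r hr y hy
    rw [mem_ball_zero_iff] at hy
    rw [norm_mul, Real.norm_of_nonneg (by positivity : 0 ≤ r ^ (-(1 + α + d)))]
    gcongr
    rw [Real.norm_eq_abs]
    rcases min_choice 1 (r ^ 2) with h | h <;> rw [h]
    · simpa using h1 y
    · refine (h2 y).trans ?_
      gcongr
  constructor
  · filter_upwards [ae_restrict_mem measurableSet_Ioi] with r hr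
    rw [kerF_left, integrable_indicator_iff measurableSet_ball]
    refine Measure.integrableOn_of_bounded (M := C * min 1 (r ^ 2) * r ^ (-(1 + α + d)))
      measure_ball_lt_top.ne (by fun_prop) ?_
    filter_upwards [ae_restrict_mem measurableSet_ball] with y hy using key r hr y hy
  · have h := (aux_r α hα0 hα2).const_mul (C * V1 d)
    refine Integrable.mono' h ?_ ?_
    · exact ((kerF_meas α k hk).norm.stronglyMeasurable.integral_prod_right').aestronglyMeasurable
    · filter_upwards [ae_restrict_mem measurableSet_Ioi] with r hr
      have hr : 0 < r := hr
      have e : (fun y => ‖kerF α k (r, y)‖) =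
          (Metric.ball (0 : Euc d) r).indicator (fun y => ‖k y * r ^ (-(1 + α + d))‖) := by
        ext y
        rw [congrFun (kerF_left α k r) y, norm_indicator_eq_indicator_norm]
      rw [e, integral_indicator measurableSet_ball]
      refine (norm_setIntegral_le_of_norm_le_const (C := C * min 1 (r ^ 2) * r ^ (-(1 + α + d)))
        measure_ball_lt_top (fun y hy => ?_)).trans ?_
      · rw [norm_norm]; exact key r hr y hy
      · rw [Measure.real, vol_ball' _ hr]
        have : r ^ (-(1 + α)) = r ^ (-(1 + α + d)) * r ^ d := by
          rw [← Real.rpow_natCast, ← Real.rpow_add hr]; congr 1; ring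
        rw [this]
        apply le_of_eq; ring

lemma kerF_int_r {d : ℕ} (α : ℝ) (hα0 : 0 < α) (k : Euc d → ℝ) (h0 : k 0 = 0) (y : Euc d) :
    ∫ r in Set.Ioi (0 : ℝ), kerF α k (r, y) = (1 / (d + α)) * (k y / ‖y‖ ^ ((d : ℝ) + α)) := by
  by_cases hy : y = 0
  · subst hy
    rw [kerF_right]; simp [h0]
  have hy' : 0 < ‖y‖ := norm_pos_iff.2 hy
  have hd : (0 : ℝ) ≤ d := Nat.cast_nonneg d
  rw [kerF_right, integral_indicator measurableSet_Ioi, Measure.restrict_restrict measurableSet_Ioi,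
    Set.inter_eq_left.2 (Set.Ioi_subset_Ioi hy'.le), integral_const_mul,
    integral_Ioi_rpow_of_lt (by linarith) hy']
  rw [show -(1 + α + (d : ℝ)) + 1 = -(d + α) by ring, Real.rpow_neg hy'.le]
  have : (d : ℝ) + α ≠ 0 := by positivity
  field_simp

lemma main_k {d : ℕ} (α : ℝ) (hα0 : 0 < α) (hα2 : α < 2) (k : Euc d → ℝ)
    (hk : Measurable k) (C : ℝ) (h1 : ∀ y, |k y| ≤ C) (h2 : ∀ y, |k y| ≤ C * ‖y‖ ^ 2) :
    IntegrableOn (fun r : ℝ => (∫ y in Metric.ball (0 : Euc d) r, k y) * r ^ (-(1 + α + d)))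
      (Set.Ioi 0) ∧
    Integrable (fun y => k y / ‖y‖ ^ ((d : ℝ) + α)) ∧
    ∫ r in Set.Ioi (0 : ℝ), (∫ y in Metric.ball (0 : Euc d) r, k y) * r ^ (-(1 + α + d))
      = (1 / (d + α)) * ∫ y, k y / ‖y‖ ^ ((d : ℝ) + α) := by
  have hI := kerF_integrable α hα0 hα2 k hk C h1 h2
  have h0 : k 0 = 0 := by simpa using h2 0
  have hd : (0 : ℝ) < d + α := by positivity
  have e1 : ∀ r, ∫ y, kerF α k (r, y) =
      (∫ y in Metric.ball (0 : Euc d) r, k y) * r ^ (-(1 + α + d)) := by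
    intro r
    rw [kerF_left, integral_indicator measurableSet_ball, integral_mul_const]
  refine ⟨?_, ?_, ?_⟩
  · have := hI.integral_prod_left
    simp only [e1] at this
    exact this
  · have := hI.integral_prod_right
    simp only [kerF_int_r α hα0 k h0] at this
    have h := this.const_mul (d + α)
    refine h.congr (Eventually.of_forall fun y => ?_)
    simp only
    rw [← mul_assoc, mul_one_div_cancel hd.ne', one_mul]
  · simp_rw [← e1]
    rw [integral_integral_swap (f := fun r y => kerF α k (r, y)) hI]
    simp_rw [kerF_int_r α hα0 k h0]
    rw [integral_const_mul]

lemma c2_bound {d : ℕ} (φ : Euc d → ℝ) (hφ : ContDiff ℝ 2 φ) (x : Euc d) :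
    ∃ K > 0, ∃ δ > 0, ∀ y, ‖y‖ < δ → |φ (x + y) + φ (x - y) - 2 * φ x| ≤ K * ‖y‖ ^ 2 := by
  have hf : ContDiff ℝ 1 (fderiv ℝ φ) := hφ.fderiv_right (by norm_num)
  obtain ⟨K, t, ht, hK⟩ := (hf.contDiffAt (x := x)).exists_lipschitzOnWith
  obtain ⟨δ, hδ, hball⟩ := Metric.mem_nhds_iff.1 ht
  refine ⟨2 * K + 1, by positivity, δ, hδ, fun y hy => ?_⟩
  have hdiff : Differentiable ℝ φ := hφ.differentiable (by norm_num)
  have hder : ∀ z, HasFDerivAt (fun z => φ (x + z) + φ (x - z) - 2 * φ x)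
      (fderiv ℝ φ (x + z) - fderiv ℝ φ (x - z)) z := by
    intro z
    have a := (hdiff (x + z)).hasFDerivAt.comp z ((hasFDerivAt_id z).const_add x)
    have b := (hdiff (x - z)).hasFDerivAt.comp z ((hasFDerivAt_id z).const_sub x)
    have c := (a.add b).sub_const (2 * φ x)
    refine c.congr_fderiv ?_
    ext v; simp [sub_eq_add_neg]
  have := (convex_closedBall (0 : Euc d) ‖y‖).norm_image_sub_le_of_norm_hasFDerivWithin_le
    (C := 2 * K * ‖y‖) (fun z _ => (hder z).hasFDerivWithinAt) (fun z hz => ?_)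
    (mem_closedBall_self (norm_nonneg y)) (show y ∈ _ by simp)
  · simp only [sub_zero, add_zero, Real.norm_eq_abs] at this
    rw [show φ x + φ x - 2 * φ x = 0 by ring, sub_zero] at this
    nlinarith [sq_nonneg ‖y‖]
  · rw [mem_closedBall_zero_iff] at hz
    have hz' := hz.trans_lt hy
    have := hK.dist_le_mul (x + z) (hball (by simpa using hz')) (x - z) (hball (by simpa using hz'))
    rw [dist_eq_norm, dist_eq_norm] at this
    refine this.trans ?_
    rw [show x + z - (x - z) = (2 : ℝ) • z by rw [two_smul]; abel, norm_smul]
    norm_num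
    nlinarith [K.coe_nonneg]

lemma int_sym {d : ℕ} (s : Set (Euc d)) (hs : MeasurableSet s) (hsym : ∀ y, -y ∈ s ↔ y ∈ s)
    (f : Euc d → ℝ) (hf : IntegrableOn f s) :
    ∫ y in s, (f y + f (-y)) / 2 = ∫ y in s, f y := by
  have e : s.indicator (fun y => f (-y)) = fun y => s.indicator f (-y) := by
    ext y
    by_cases h : y ∈ s
    · rw [Set.indicator_of_mem h, Set.indicator_of_mem ((hsym y).2 h)]
    · rw [Set.indicator_of_notMem h, Set.indicator_of_notMem (fun h' => h ((hsym y).1 h'))]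
  have hf' : IntegrableOn (fun y => f (-y)) s := by
    rw [← integrable_indicator_iff hs, e]
    exact ((integrable_indicator_iff hs).2 hf).comp_neg
  have e2 : ∫ y in s, f (-y) = ∫ y in s, f y := by
    rw [← integral_indicator hs, e, integral_neg_eq_self (s.indicator f), integral_indicator hs]
  rw [integral_div, integral_add hf hf', e2]
  ring

lemma int_trans {d : ℕ} (x : Euc d) (s t : Set (Euc d)) (hs : MeasurableSet s)
    (ht : MeasurableSet t) (h : ∀ y, x + y ∈ s ↔ y ∈ t) (f : Euc d → ℝ) :
    ∫ z in s, f z = ∫ y in t, f (x + y) := by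
  rw [← integral_indicator hs, ← integral_indicator ht,
    ← integral_add_left_eq_self (s.indicator f) x]
  congr 1
  ext y
  by_cases hy : y ∈ t
  · rw [Set.indicator_of_mem hy, Set.indicator_of_mem ((h y).2 hy)]
  · rw [Set.indicator_of_notMem hy, Set.indicator_of_notMem (fun h' => hy ((h y).1 h'))]

lemma lim_ball {d : ℕ} (H : Euc d → ℝ) (hH : Integrable H) (h0 : H 0 = 0) :
    Tendsto (fun ε : ℝ => ∫ y in (Metric.ball (0 : Euc d) ε)ᶜ, H y) (𝓝[>] (0 : ℝ))
      (𝓝 (∫ y, H y)) := by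
  simp_rw [← fun ε : ℝ => integral_indicator (μ := volume) (f := H)
    (measurableSet_ball (x := (0 : Euc d)) (ε := ε)).compl]
  refine tendsto_integral_filter_of_dominated_convergence (fun y => ‖H y‖) ?_ ?_ hH.norm ?_
  · exact Eventually.of_forall fun ε => hH.aestronglyMeasurable.indicator measurableSet_ball.compl
  · exact Eventually.of_forall fun ε => Eventually.of_forall fun y => norm_indicator_le_norm_self _ _
  · refine Eventually.of_forall fun y => ?_
    refine tendsto_const_nhds.congr' ?_
    by_cases hy : y = 0
    · subst hy
      exact Eventually.of_forall fun ε => by simp [Set.indicator, h0]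
    · have : Set.Iio ‖y‖ ∈ 𝓝[>] (0 : ℝ) := nhdsWithin_le_nhds (Iio_mem_nhds (norm_pos_iff.2 hy))
      filter_upwards [this] with ε hε
      rw [Set.indicator_of_mem]
      simpa using (le_of_lt hε : ε ≤ ‖y‖)

theorem core {d : ℕ} (α : ℝ) (hα0 : 0 < α) (hα2 : α < 2)
    (φ : Euc d → ℝ) (hφ : ContDiff ℝ 2 φ) (M : ℝ) (hM : ∀ x, |φ x| ≤ M) (x : Euc d) :
    IntegrableOn (fun r : ℝ => (ballAvg φ r x - φ x) / r ^ (1 + α)) (Set.Ioi 0) volume ∧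
    ∃ L : ℝ,
      Tendsto (fun ε : ℝ =>
          ∫ z in (Metric.ball x ε)ᶜ, (φ z - φ x) / ‖z - x‖ ^ ((d : ℝ) + α))
        (𝓝[>] (0 : ℝ)) (𝓝 L) ∧
      ∫ r in Set.Ioi (0 : ℝ), (ballAvg φ r x - φ x) / r ^ (1 + α)
        = 1 / (V1 d * ((d : ℝ) + α)) * L := by
  obtain ⟨K, hK, δ, hδ, hKδ⟩ := c2_bound φ hφ x
  have hM0 : 0 ≤ M := (abs_nonneg _).trans (hM 0)
  set g : Euc d → ℝ := fun y => φ (x + y) - φ x with hg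
  set h : Euc d → ℝ := fun y => (g y + g (-y)) / 2 with hh
  have hφc : Continuous φ := hφ.continuous
  have hgc : Continuous g := by fun_prop
  have hhc : Continuous h := by fun_prop
  have hgb : ∀ y, |g y| ≤ 2 * M := fun y => by
    refine (abs_sub _ _).trans ?_
    linarith [hM (x + y), hM x]
  have hhb : ∀ y, |h y| ≤ 2 * M := fun y => by
    have a := abs_le.1 (hgb y)
    have b := abs_le.1 (hgb (-y))
    simp only [hh]
    rw [abs_le]; constructor <;> linarith
  have hh2 : ∀ y, |h y| ≤ (2 * M + K + 2 * M / δ ^ 2) * ‖y‖ ^ 2 := fun y => by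
    rcases lt_or_ge ‖y‖ δ with hy | hy
    · have a := hKδ y hy
      have : h y = (φ (x + y) + φ (x - y) - 2 * φ x) / 2 := by
        simp only [hh, hg, sub_eq_add_neg]; ring
      rw [this, abs_div, abs_two]
      have : (0 : ℝ) ≤ (2 * M + 2 * M / δ ^ 2) * ‖y‖ ^ 2 := by positivity
      have : (0 : ℝ) ≤ K * ‖y‖ ^ 2 := by positivity
      linarith
    · refine (hhb y).trans ?_
      have h1 : 2 * M ≤ 2 * M / δ ^ 2 * ‖y‖ ^ 2 := by
        rw [div_mul_eq_mul_div, le_div_iff₀ (by positivity)]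
        gcongr
      have : (0 : ℝ) ≤ (2 * M + K) * ‖y‖ ^ 2 := by positivity
      linarith
  obtain ⟨hA, hB, hC⟩ := main_k α hα0 hα2 h hhc.measurable (2 * M + K + 2 * M / δ ^ 2)
    (fun y => (hhb y).trans (by
      have : 0 ≤ 2 * M / δ ^ 2 := by positivity
      linarith)) hh2
  have hV : 0 < V1 d := by
    unfold V1
    exact ENNReal.toReal_pos (measure_ball_pos _ _ one_pos).ne' measure_ball_lt_top.ne
  have hd : (0 : ℝ) < d + α := by positivity
  have hr : ∀ r ∈ Set.Ioi (0 : ℝ), (ballAvg φ r x - φ x) / r ^ (1 + α) =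
      (V1 d)⁻¹ * ((∫ y in Metric.ball (0 : Euc d) r, h y) * r ^ (-(1 + α + d))) := by
    intro r hr
    have hr : 0 < r := hr
    have hint : ∀ f : Euc d → ℝ, Continuous f → IntegrableOn f (Metric.ball 0 r) := fun f hf =>
      (hf.continuousOn.integrableOn_compact (isCompact_closedBall (0 : Euc d) r)).mono_set
        ball_subset_closedBall
    have e1 : ∫ y in Metric.ball (0 : Euc d) r, h y =
        (∫ y in Metric.ball x r, φ y) - r ^ d * V1 d * φ x := by
      rw [int_sym _ measurableSet_ball (by simp) g (hint g hgc),
        int_trans x (Metric.ball x r) (Metric.ball 0 r) measurableSet_ball measurableSet_ball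
          (by simp) φ, integral_sub (hint _ (by fun_prop)) (hint _ continuous_const),
          setIntegral_const, Measure.real, vol_ball' _ hr, smul_eq_mul]
    rw [e1, ballAvg, if_neg hr.ne', vol_ball' _ hr]
    have : r ^ (-(1 + α + d)) = (r ^ (1 + α))⁻¹ * (r ^ d)⁻¹ := by
      rw [Real.rpow_neg hr.le, Real.rpow_add hr, Real.rpow_natCast, mul_inv]
    rw [this]
    have : 0 < r ^ (1 + α) := by positivity
    field_simp
  refine ⟨?_, ∫ y, h y / ‖y‖ ^ ((d : ℝ) + α), ?_, ?_⟩
  · rw [integrableOn_congr_fun hr measurableSet_Ioi]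
    exact hA.const_mul _
  · have hlim := lim_ball _ hB (by simp [hd.ne'])
    refine hlim.congr' ?_
    filter_upwards [self_mem_nhdsWithin] with ε hε
    have hε : 0 < ε := hε
    rw [int_trans x (Metric.ball x ε)ᶜ (Metric.ball 0 ε)ᶜ measurableSet_ball.compl
      measurableSet_ball.compl (by simp)]
    simp only [add_sub_cancel_left]
    obtain ⟨-, hgi, -⟩ := main_k α hα0 hα2 ((Metric.ball (0 : Euc d) ε)ᶜ.indicator g)
      (hgc.measurable.indicator measurableSet_ball.compl) (2 * M + 2 * M / ε ^ 2)
      (fun y => by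
        have h1 : 0 ≤ 2 * M / ε ^ 2 := by positivity
        have h2 := norm_indicator_le_norm_self (s := (Metric.ball (0 : Euc d) ε)ᶜ) g y
        rw [Real.norm_eq_abs, Real.norm_eq_abs] at h2
        linarith [hgb y])
      (fun y => by
        by_cases hy : y ∈ (Metric.ball (0 : Euc d) ε)ᶜ
        · rw [Set.indicator_of_mem hy]
          have hy : ε ≤ ‖y‖ := by simpa using hy
          refine (hgb y).trans ?_
          have h1 : 2 * M ≤ 2 * M / ε ^ 2 * ‖y‖ ^ 2 := by
            rw [div_mul_eq_mul_div, le_div_iff₀ (by positivity)]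
            gcongr
          have : (0 : ℝ) ≤ (2 * M) * ‖y‖ ^ 2 := by positivity
          linarith
        · rw [Set.indicator_of_notMem hy, abs_zero]; positivity)
    have hgi' : IntegrableOn (fun y => g y / ‖y‖ ^ ((d : ℝ) + α)) (Metric.ball (0 : Euc d) ε)ᶜ := by
      rw [← integrable_indicator_iff measurableSet_ball.compl]
      refine hgi.congr (Eventually.of_forall fun y => ?_)
      by_cases hy : y ∈ (Metric.ball (0 : Euc d) ε)ᶜ
      · simp only [Set.indicator_of_mem hy]
      · simp only [Set.indicator_of_notMem hy, zero_div]
    have := int_sym _ measurableSet_ball.compl (by simp) _ hgi'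
    rw [← this]
    congr 1
    ext y
    simp only [hh, norm_neg]
    ring
  · rw [setIntegral_congr_fun measurableSet_Ioi hr, integral_const_mul, hC]
    field_simp

/-- for `α ∈ (0,2)`, `ζ > 0` and `φ` twice continuously differentiable with
`‖φ‖_∞` and `max_{|κ|≤2} ‖∂_κ φ‖_∞` finite, the integral
`ζ ∫₀^∞ (φ̄(x,r) − φ(x)) dr/r^{1+α}` is absolutely convergent, the principal-value limit
exists, and the integral equals `(ζ/(V₁(d+α)))` times that limit. -/
theorem stmt8 {d : ℕ} (α ζ : ℝ) (hα0 : 0 < α) (hα2 : α < 2) (hζ : 0 < ζ)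
    (φ : Euc d → ℝ) (hφ : ContDiff ℝ 2 φ)
    (hbd : ∀ l : List (Fin d), l.length ≤ 2 → ∃ M : ℝ, ∀ x, |listD l φ x| ≤ M)
    (x : Euc d) :
    IntegrableOn (fun r : ℝ => (ballAvg φ r x - φ x) / r ^ (1 + α)) (Set.Ioi 0) volume ∧
    ∃ L : ℝ,
      Tendsto (fun ε : ℝ =>
          ∫ z in (Metric.ball x ε)ᶜ, (φ z - φ x) / ‖z - x‖ ^ ((d : ℝ) + α))
        (𝓝[>] (0 : ℝ)) (𝓝 L) ∧
      ζ * ∫ r in Set.Ioi (0 : ℝ), (ballAvg φ r x - φ x) / r ^ (1 + α)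
        = ζ / (V1 d * ((d : ℝ) + α)) * L := by
  obtain ⟨M, hM⟩ := hbd [] (by simp)
  obtain ⟨hA, L, hL, hE⟩ := core α hα0 hα2 φ hφ M hM x
  refine ⟨hA, L, hL, ?_⟩
  rw [hE]
  ring

end
end

section
/- Let r > 0, let p, q ∈ (1,∞) with 1/p + 1/q = 1, and let Ψ : ℝ^d × ℝ^d → [0,∞) be measurable. Then ∫_{ℝ^d} ∫_{ℝ^d} V_r(x₁,x₂) Ψ(x₁,x₂) dx₁ dx₂ ≤ V_r^{2/p + 1/q} · ∫_{ℝ^d} ( ∫_{ℝ^d} Ψ(x₁,x₂)^q dx₂ )^{1/q} dx₁. -/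
open MeasureTheory Metric Set
open scoped ENNReal

noncomputable section

/-- The overlap volume is measurable in the second centre. -/
lemma overlap_measurable {d : ℕ} (r : ℝ) (x : Euc d) :
    Measurable (fun y : Euc d => volume (Metric.ball x r ∩ Metric.ball y r)) ∧
    ∫⁻ y : Euc d, volume (Metric.ball x r ∩ Metric.ball y r)
      = volume (Metric.ball (0 : Euc d) r) * volume (Metric.ball (0 : Euc d) r) := by
  have hS : MeasurableSet {z : Euc d × Euc d | z.2 ∈ Metric.ball x r ∧ dist z.2 z.1 < r} := by
    apply IsOpen.measurableSet
    apply IsOpen.inter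
    · exact Metric.isOpen_ball.preimage continuous_snd
    · exact isOpen_lt (continuous_snd.dist continuous_fst) continuous_const
  have hl : ∀ y : Euc d, Prod.mk y ⁻¹' {z : Euc d × Euc d | z.2 ∈ Metric.ball x r ∧ dist z.2 z.1 < r}
      = Metric.ball x r ∩ Metric.ball y r := by
    intro y; ext w; simp
  constructor
  · have := measurable_measure_prodMk_left (ν := (volume : Measure (Euc d))) hS
    simpa only [hl] using this
  · have h1 := Measure.prod_apply (μ := (volume : Measure (Euc d)))
      (ν := (volume : Measure (Euc d))) hS
    have h2 := Measure.prod_apply_symm (μ := (volume : Measure (Euc d)))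
      (ν := (volume : Measure (Euc d))) hS
    simp only [hl] at h1
    rw [← h1, h2]
    have h3 : ∀ w : Euc d, volume ((fun y : Euc d => (y, w)) ⁻¹'
        {z : Euc d × Euc d | z.2 ∈ Metric.ball x r ∧ dist z.2 z.1 < r})
        = (Metric.ball x r).indicator (fun _ => volume (Metric.ball (0 : Euc d) r)) w := by
      intro w
      by_cases hw : w ∈ Metric.ball x r
      · rw [Set.indicator_of_mem hw, ← Measure.addHaar_ball_center volume w r]
        congr 1
        ext y
        rw [Metric.mem_ball, dist_comm]
        exact ⟨fun h => h.2, fun h => ⟨hw, h⟩⟩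
      · rw [Set.indicator_of_notMem hw]
        simp only [Set.preimage_ofPred_eq, hw, false_and, Set.ofPred_false, measure_empty]
    simp_rw [h3]
    rw [lintegral_indicator_const measurableSet_ball, Measure.addHaar_ball_center volume x r]

/-- for `r > 0`, Hölder conjugate exponents `p, q ∈ (1,∞)` and measurable
`Ψ : ℝ^d × ℝ^d → [0,∞)`,
`∫∫ V_r(x₁,x₂) Ψ(x₁,x₂) dx₁ dx₂ ≤ V_r^{2/p + 1/q} ∫ (∫ Ψ(x₁,x₂)^q dx₂)^{1/q} dx₁`
(stated with Lebesgue integrals, both sides possibly infinite). -/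
theorem stmt14 {d : ℕ} (r : ℝ) (hr : 0 < r) (p q : ℝ)
    (hp : 1 < p) (hq : 1 < q) (hpq : 1 / p + 1 / q = 1)
    (Ψ : Euc d → Euc d → ℝ)
    (hΨm : Measurable (fun z : Euc d × Euc d => Ψ z.1 z.2))
    (hΨ0 : ∀ x y, 0 ≤ Ψ x y) :
    ∫⁻ x₁ : Euc d, ∫⁻ x₂ : Euc d,
        volume (Metric.ball x₁ r ∩ Metric.ball x₂ r) * ENNReal.ofReal (Ψ x₁ x₂)
      ≤ (volume (Metric.ball (0 : Euc d) r)) ^ (2 / p + 1 / q) *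
        ∫⁻ x₁ : Euc d, (∫⁻ x₂ : Euc d, ENNReal.ofReal (Ψ x₁ x₂) ^ q) ^ (1 / q) := by
  have hpq' : p.HolderConjugate q := by
    rw [Real.holderConjugate_iff]
    exact ⟨hp, by simpa only [one_div] using hpq⟩
  set V := volume (Metric.ball (0 : Euc d) r) with hV
  have hV0 : V ≠ 0 := (Metric.measure_ball_pos volume _ hr).ne'
  have hVt : V ≠ ∞ := measure_ball_lt_top.ne
  have hp0 : 0 < p := by linarith
  rw [← lintegral_const_mul' _ _ (ENNReal.rpow_ne_top_of_ne_zero hV0 hVt)]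
  apply lintegral_mono
  intro x
  obtain ⟨hm, hi⟩ := overlap_measurable r x
  have hΨx : Measurable (fun y => ENNReal.ofReal (Ψ x y)) :=
    (hΨm.comp measurable_prodMk_left).ennreal_ofReal
  refine (ENNReal.lintegral_mul_le_Lp_mul_Lq volume hpq' hm.aemeasurable
    hΨx.aemeasurable).trans ?_
  refine mul_le_mul' ?_ le_rfl
  have hle : ∫⁻ y : Euc d, volume (Metric.ball x r ∩ Metric.ball y r) ^ p ≤ V ^ (p + 1) := by
    calc _ ≤ ∫⁻ y : Euc d, V ^ (p - 1) * volume (Metric.ball x r ∩ Metric.ball y r) := by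
          apply lintegral_mono
          intro y
          have hb : volume (Metric.ball x r ∩ Metric.ball y r) ≤ V := by
            rw [hV, ← Measure.addHaar_ball_center volume x r]
            exact measure_mono Set.inter_subset_left
          have he : p = (p - 1) + 1 := by ring
          calc volume (Metric.ball x r ∩ Metric.ball y r) ^ p
              = volume (Metric.ball x r ∩ Metric.ball y r) ^ (p - 1)
                * volume (Metric.ball x r ∩ Metric.ball y r) := by
                conv_lhs => rw [he]
                rw [ENNReal.rpow_add_of_nonneg _ _ (by linarith) zero_le_one, ENNReal.rpow_one]
            _ ≤ _ := by
                exact mul_le_mul' (ENNReal.rpow_le_rpow hb (by linarith)) le_rfl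
      _ = V ^ (p - 1) * (V * V) := by rw [lintegral_const_mul _ hm, hi]
      _ = V ^ (p + 1) := by
          rw [show p + 1 = (p - 1) + (1 + 1) by ring, ENNReal.rpow_add _ _ hV0 hVt,
            ENNReal.rpow_add _ _ hV0 hVt, ENNReal.rpow_one]
  calc _ ≤ (V ^ (p + 1)) ^ (1 / p) := by gcongr
    _ = _ := by
      rw [← ENNReal.rpow_mul]
      congr 1
      have : (p + 1) * (1 / p) = 1 + 1 / p := by field_simp
      rw [this]
      have h2 : 2 / p = 1 / p + 1 / p := by ring
      linarith

end
end
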